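/- arXiv:1010.1144 — 6 statements merged into one kernel-verified Lean document; each statement's English description precedes it below -/
import Mathlib

section
/- Each of N₁, N₂, N₃ is a normal subgroup of Γ, and for every surjective group homomorphism φ : Γ → D∞ onto the infinite dihedral group, ker φ ∈ {N₁, N₂, N₃}. Conversely, each Nᵢ is the kernel of some surjective homomorphism Γ → D∞. -/
/-- The relators of the Passman fours group:
`y⁻¹x²y·x²` and `x⁻¹y²x·y²` (i.e. `y⁻¹x²y = x⁻²` and `x⁻¹y²x = y⁻²`). -/
def foursRels : Set (FreeGroup (Fin 2)) :=
  { (FreeGroup.of 1)⁻¹ * (FreeGroup.of 0) ^ 2 * FreeGroup.of 1 * (FreeGroup.of 0) ^ 2,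
    (FreeGroup.of 0)⁻¹ * (FreeGroup.of 1) ^ 2 * FreeGroup.of 0 * (FreeGroup.of 1) ^ 2 }

/-- The Passman fours group `Γ = ⟨x, y ∣ y⁻¹x²y = x⁻², x⁻¹y²x = y⁻²⟩`. -/
abbrev Fours : Type := PresentedGroup foursRels

/-- The generator `x` of `Γ`. -/
def fx : Fours := PresentedGroup.of 0

/-- The generator `y` of `Γ`. -/
def fy : Fours := PresentedGroup.of 1

/-- `a = x²`. -/
def fa : Fours := fx ^ 2
/-- `b = y²`. -/
def fb : Fours := fy ^ 2
/-- `c = (xy)²`. -/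
def fc : Fours := (fx * fy) ^ 2

/-- `N₁ = ⟨a, b⟩`. -/
def N₁ : Subgroup Fours := Subgroup.closure {fa, fb}
/-- `N₂ = ⟨a, c⟩`. -/
def N₂ : Subgroup Fours := Subgroup.closure {fa, fc}
/-- `N₃ = ⟨b, c⟩`. -/
def N₃ : Subgroup Fours := Subgroup.closure {fb, fc}

/-- Every element of a group generated by `u` and `v` lies, modulo a normal subgroup containing
`u ^ 2` and `v ^ 2`, in the coset of some `(u * v) ^ k` or `(u * v) ^ k * u`. -/
theorem mk_eq_zpow_or_zpow_mul_of_sq_mem {G : Type*} [Group G] {u v : G} (N : Subgroup G)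
    [N.Normal] (huv : Subgroup.closure {u, v} = ⊤) (hu : u ^ 2 ∈ N) (hv : v ^ 2 ∈ N) (g : G) :
    ∃ k : ℤ, (g : G ⧸ N) = ((u * v) ^ k : G) ∨ (g : G ⧸ N) = ((u * v) ^ k * u : G) := by
  have hu2 : (u : G ⧸ N) * u = 1 := by
    rw [← pow_two]; exact (QuotientGroup.eq_one_iff (u ^ 2)).2 hu
  have hv2 : (v : G ⧸ N) * v = 1 := by
    rw [← pow_two]; exact (QuotientGroup.eq_one_iff (v ^ 2)).2 hv
  have hui : (u : G ⧸ N)⁻¹ = u := inv_eq_of_mul_eq_one_left hu2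
  have hvi : (v : G ⧸ N)⁻¹ = v := inv_eq_of_mul_eq_one_left hv2
  have step_u (h : G)
      (hh : ∃ k : ℤ, (h : G ⧸ N) = ((u * v) ^ k : G) ∨ (h : G ⧸ N) = ((u * v) ^ k * u : G)) :
      ∃ k : ℤ, (h * u : G ⧸ N) = ((u * v) ^ k : G) ∨ (h * u : G ⧸ N) = ((u * v) ^ k * u : G) := by
    obtain ⟨k, hk | hk⟩ := hh
    · exact ⟨k, .inr (by rw [hk]; simp)⟩
    · exact ⟨k, .inl (by rw [hk]; simp [mul_assoc, hu2])⟩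
  have step_v (h : G)
      (hh : ∃ k : ℤ, (h : G ⧸ N) = ((u * v) ^ k : G) ∨ (h : G ⧸ N) = ((u * v) ^ k * u : G)) :
      ∃ k : ℤ, (h * v : G ⧸ N) = ((u * v) ^ k : G) ∨ (h * v : G ⧸ N) = ((u * v) ^ k * u : G) := by
    obtain ⟨k, hk | hk⟩ := hh
    · exact ⟨k - 1, .inr (by
        rw [hk]; simp [zpow_sub_one, mul_assoc, hvi])⟩
    · exact ⟨k + 1, .inl (by rw [hk]; simp [zpow_add_one, mul_assoc])⟩
  have hg : g ∈ Subgroup.closure {u, v} := huv ▸ Subgroup.mem_top g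
  induction hg using Subgroup.closure_induction_right with
  | one => exact ⟨0, .inl (by simp)⟩
  | mul_right h _ w hw ih =>
    rcases hw with rfl | rfl
    · simpa using step_u h ih
    · simpa using step_v h ih
  | mul_inv_cancel h _ w hw ih =>
    rcases hw with rfl | rfl
    · simpa [hui] using step_u h ih
    · simpa [hvi] using step_v h ih

/-- A surjection onto `D∞` sending two generators `u`, `v` to reflections has kernel
`⟨u ^ 2, v ^ 2⟩`, as soon as that subgroup is normal. -/
theorem ker_eq_closure_sq_of_map_eq_sr {G : Type*} [Group G] {u v : G}
    (huv : Subgroup.closure {u, v} = ⊤) (hN : (Subgroup.closure {u ^ 2, v ^ 2}).Normal)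
    (φ : G →* DihedralGroup 0) (hφ : Function.Surjective φ) {i j : ZMod 0}
    (hi : φ u = .sr i) (hj : φ v = .sr j) :
    φ.ker = Subgroup.closure {u ^ 2, v ^ 2} := by
  have hle : Subgroup.closure {u ^ 2, v ^ 2} ≤ φ.ker := by
    rw [Subgroup.closure_le]
    rintro _ (rfl | rfl) <;> simp [MonoidHom.mem_ker, pow_two, hi, hj]
  have hw (k : ℤ) : φ ((u * v) ^ k) = .r ((j - i) * Int.cast k) := by
    rw [map_zpow, map_mul, hi, hj, DihedralGroup.sr_mul_sr, DihedralGroup.r_zpow]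
  have key (g : G) : ∃ k : ℤ, (φ g = .r ((j - i) * Int.cast k) ∧
      (k = 0 → g ∈ Subgroup.closure {u ^ 2, v ^ 2})) ∨ ∃ l, φ g = .sr l := by
    obtain ⟨k, hk | hk⟩ := mk_eq_zpow_or_zpow_mul_of_sq_mem
      (Subgroup.closure {u ^ 2, v ^ 2}) huv
      (Subgroup.subset_closure (Set.mem_insert _ _))
      (Subgroup.subset_closure (Set.mem_insert_of_mem _ rfl)) g
    all_goals
      refine ⟨k, ?_⟩
      have hφk := MonoidHom.mem_ker.1 (hle (QuotientGroup.eq.1 hk))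
      rw [map_mul, map_inv, inv_mul_eq_one] at hφk
    · refine .inl ⟨hφk.trans (hw k), ?_⟩
      rintro rfl
      exact (QuotientGroup.eq_one_iff g).1 (by simpa using hk)
    · exact .inr ⟨_, by rw [hφk, map_mul, hw, hi, DihedralGroup.r_mul_sr]⟩
  have hd : j - i ≠ 0 := by
    intro hd
    obtain ⟨g, hg⟩ := hφ (.r 1)
    obtain ⟨k, ⟨hk, -⟩ | ⟨l, hl⟩⟩ := key g
    · rw [hg, hd, zero_mul, DihedralGroup.r.injEq] at hk
      exact one_ne_zero (α := ℤ) hk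
    · rw [hg] at hl
      cases hl
  refine le_antisymm (fun g hg ↦ ?_) hle
  rw [MonoidHom.mem_ker, DihedralGroup.one_def] at hg
  obtain ⟨k, ⟨hk, hmem⟩ | ⟨l, hl⟩⟩ := key g
  · rw [hg, DihedralGroup.r.injEq] at hk
    exact hmem ((mul_eq_zero (M₀ := ℤ)).1 hk.symm |>.resolve_left hd)
  · rw [hg] at hl
    cases hl

/-- A homomorphism to `D∞` hitting `r 1` and some reflection is surjective. -/
theorem surjective_of_r_one_mem_range_of_sr_mem_range {G : Type*} [Group G]
    (φ : G →* DihedralGroup 0) {i : ZMod 0} (hr : .r 1 ∈ φ.range) (hs : .sr i ∈ φ.range) :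
    Function.Surjective φ := by
  have hrot (k : ZMod 0) : .r k ∈ φ.range := by
    have := zpow_mem hr (show ℤ from k)
    rw [DihedralGroup.r_one_zpow] at this
    exact this
  rw [← MonoidHom.range_eq_top, eq_top_iff]
  rintro (k | k) -
  · exact hrot k
  · simpa using mul_mem hs (hrot (k - i))

/-- A subgroup generated by elements which each member of a generating set centralizes or inverts
is normal. -/
theorem normal_closure_of_conj_eq_or_eq_inv {G : Type*} [Group G] {S T : Set G}
    (hS : Subgroup.closure S = ⊤)
    (h : ∀ g ∈ S, ∀ t ∈ T, g * t * g⁻¹ = t ∨ g * t * g⁻¹ = t⁻¹) :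
    (Subgroup.closure T).Normal := by
  have hconj (g : G) : ∀ t ∈ T, g * t * g⁻¹ = t ∨ g * t * g⁻¹ = t⁻¹ := by
    have hg : g ∈ Subgroup.closure S := hS ▸ Subgroup.mem_top g
    induction hg using Subgroup.closure_induction with
    | mem g hg => exact h g hg
    | one => simp
    | mul g g' _ _ ih ih' =>
      intro t ht
      have e : g * g' * t * (g * g')⁻¹ = g * (g' * t * g'⁻¹) * g⁻¹ := by group
      rw [e]
      rcases ih' t ht with h' | h' <;> rw [h']
      · exact ih t ht
      · rw [← conj_inv, inv_inj, inv_eq_iff_eq_inv]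
        exact (ih t ht).symm
    | inv g _ ih =>
      intro t ht
      rcases ih t ht with h' | h'
      · left
        nth_rw 1 [← h']
        group
      · right
        rw [← inv_eq_iff_eq_inv] at h'
        nth_rw 1 [← h']
        group
  refine ⟨fun n hn g ↦ ?_⟩
  induction hn using Subgroup.closure_induction with
  | mem t ht =>
    rcases hconj g t ht with e | e <;> rw [e]
    · exact Subgroup.subset_closure ht
    · exact inv_mem (Subgroup.subset_closure ht)
  | one => simp
  | mul s t _ _ ihs iht => rw [← conj_mul]; exact mul_mem ihs iht
  | inv t _ ih => rw [← conj_inv]; exact inv_mem ih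

theorem conj_eq_inv_of_mul_eq_mul_inv {G : Type*} [Group G] {g t : G} (h : t * g = g * t⁻¹) :
    g * t * g⁻¹ = t⁻¹ := by
  rw [mul_inv_eq_iff_eq_mul, eq_inv_mul_iff_mul_eq, ← mul_assoc, h, inv_mul_cancel_right]

theorem closure_fx_fy : Subgroup.closure {fx, fy} = ⊤ := by
  rw [← PresentedGroup.closure_range_of foursRels]
  congr 1
  ext g
  simp [fx, fy, Fin.exists_fin_two, eq_comm]

theorem closure_fx_fx_mul_fy : Subgroup.closure {fx, fx * fy} = ⊤ := by
  rw [eq_top_iff, ← closure_fx_fy, Subgroup.closure_le]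
  have hx : fx ∈ Subgroup.closure {fx, fx * fy} := Subgroup.subset_closure (.inl rfl)
  have hxy : fx * fy ∈ Subgroup.closure {fx, fx * fy} := Subgroup.subset_closure (.inr rfl)
  rintro _ (rfl | rfl)
  · exact hx
  · exact (Subgroup.mul_mem_cancel_left _ hx).1 hxy

theorem closure_fy_fx_mul_fy : Subgroup.closure {fy, fx * fy} = ⊤ := by
  rw [eq_top_iff, ← closure_fx_fy, Subgroup.closure_le]
  have hy : fy ∈ Subgroup.closure {fy, fx * fy} := Subgroup.subset_closure (.inl rfl)
  have hxy : fx * fy ∈ Subgroup.closure {fy, fx * fy} := Subgroup.subset_closure (.inr rfl)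
  rintro _ (rfl | rfl)
  · exact (Subgroup.mul_mem_cancel_right _ hy).1 hxy
  · exact hy

theorem fx_sq_mul_fy : fx ^ 2 * fy = fy * (fx ^ 2)⁻¹ := by
  have h : fy⁻¹ * fx ^ 2 * fy * fx ^ 2 = 1 :=
    PresentedGroup.one_of_mem (rels := foursRels) (.inl rfl)
  rw [mul_assoc, mul_assoc, inv_mul_eq_one, ← mul_assoc] at h
  exact eq_mul_inv_of_mul_eq h.symm

theorem fy_sq_mul_fx : fy ^ 2 * fx = fx * (fy ^ 2)⁻¹ := by
  have h : fx⁻¹ * fy ^ 2 * fx * fy ^ 2 = 1 :=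
    PresentedGroup.one_of_mem (rels := foursRels) (.inr rfl)
  rw [mul_assoc, mul_assoc, inv_mul_eq_one, ← mul_assoc] at h
  exact eq_mul_inv_of_mul_eq h.symm

theorem fy_mul_fx_sq_mul_fx_mul_fy_sq : (fy * fx) ^ 2 * (fx * fy) ^ 2 = 1 := by
  have ha : fx ^ 2 * fy = fy * (fx ^ 2)⁻¹ := fx_sq_mul_fy
  have hb : fy ^ 2 * fx = fx * (fy ^ 2)⁻¹ := fy_sq_mul_fx
  have hab : fx ^ 2 * fy ^ 2 = fy ^ 2 * fx ^ 2 := by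
    rw [pow_two fy, ← mul_assoc, ha, mul_assoc, mul_assoc]
    congr 1
    rw [inv_mul_eq_iff_eq_mul, ← mul_assoc, ha, inv_mul_cancel_right]
  calc (fy * fx) ^ 2 * (fx * fy) ^ 2
      = fy * fx * (fy * (fx ^ 2 * fy)) * fx * fy := by simp only [pow_two, mul_assoc]
    _ = fy * fx * (fy ^ 2 * (fx ^ 2)⁻¹) * fx * fy := by
        rw [ha]; simp only [pow_two, mul_assoc]
    _ = fy * fx * (fx ^ 2)⁻¹ * (fy ^ 2 * fx) * fy := by
        rw [mul_inv_eq_iff_eq_mul.2 (by rw [mul_assoc, ← hab, inv_mul_cancel_left] :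
          fy ^ 2 = (fx ^ 2)⁻¹ * fy ^ 2 * fx ^ 2)]
        simp only [mul_assoc]
    _ = 1 := by rw [hb]; group

theorem conj_fx_or_fy_eq_or_eq_inv :
    ∀ g ∈ ({fx, fy} : Set Fours), ∀ t ∈ ({fa, fb, fc} : Set Fours),
      g * t * g⁻¹ = t ∨ g * t * g⁻¹ = t⁻¹ := by
  have hc : (fy * fx) ^ 2 = ((fx * fy) ^ 2)⁻¹ :=
    eq_inv_of_mul_eq_one_left fy_mul_fx_sq_mul_fx_mul_fy_sq
  rintro _ (rfl | rfl) _ (rfl | rfl | rfl)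
  · left; rw [fa]; group
  · right; exact conj_eq_inv_of_mul_eq_mul_inv fy_sq_mul_fx
  · right
    refine conj_eq_inv_of_mul_eq_mul_inv ?_
    rw [fc, ← hc]
    simp only [pow_two, mul_assoc]
  · right; exact conj_eq_inv_of_mul_eq_mul_inv fx_sq_mul_fy
  · left; rw [fb]; group
  · right
    rw [fc, ← hc]
    simp [pow_two, mul_assoc]

theorem normal_closure_of_subset {T : Set Fours} (hT : T ⊆ {fa, fb, fc}) :
    (Subgroup.closure T).Normal :=
  normal_closure_of_conj_eq_or_eq_inv closure_fx_fy
    fun g hg t ht ↦ conj_fx_or_fy_eq_or_eq_inv g hg t (hT ht)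

theorem N₁_normal : N₁.Normal := normal_closure_of_subset (by grind)

theorem N₂_normal : N₂.Normal := normal_closure_of_subset (by grind)

theorem N₃_normal : N₃.Normal := normal_closure_of_subset (by grind)

theorem ker_eq_N₁ {φ : Fours →* DihedralGroup 0} (hφ : Function.Surjective φ) {i j : ZMod 0}
    (hx : φ fx = .sr i) (hy : φ fy = .sr j) : φ.ker = N₁ :=
  ker_eq_closure_sq_of_map_eq_sr closure_fx_fy N₁_normal φ hφ hx hy

theorem ker_eq_N₂ {φ : Fours →* DihedralGroup 0} (hφ : Function.Surjective φ) {i j : ZMod 0}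
    (hx : φ fx = .sr i) (hy : φ fy = .r j) : φ.ker = N₂ :=
  ker_eq_closure_sq_of_map_eq_sr closure_fx_fx_mul_fy N₂_normal φ hφ hx
    (by rw [map_mul, hx, hy, DihedralGroup.sr_mul_r])

theorem ker_eq_N₃ {φ : Fours →* DihedralGroup 0} (hφ : Function.Surjective φ) {i j : ZMod 0}
    (hx : φ fx = .r i) (hy : φ fy = .sr j) : φ.ker = N₃ :=
  ker_eq_closure_sq_of_map_eq_sr closure_fy_fx_mul_fy N₃_normal φ hφ hy
    (by rw [map_mul, hx, hy, DihedralGroup.r_mul_sr])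

/-- The two generators of `Γ` cannot both map to rotations under a surjection onto `D∞`. -/
theorem not_surjective_of_map_eq_r {φ : Fours →* DihedralGroup 0} {i j : ZMod 0}
    (hx : φ fx = .r i) (hy : φ fy = .r j) : ¬ Function.Surjective φ := by
  intro hφ
  have hrot (g : Fours) : ∃ k, φ g = .r k := by
    have hg : g ∈ Subgroup.closure {fx, fy} := closure_fx_fy ▸ Subgroup.mem_top g
    induction hg using Subgroup.closure_induction with
    | mem g hg =>
      rcases hg with rfl | rfl
      · exact ⟨i, hx⟩
      · exact ⟨j, hy⟩
    | one => exact ⟨0, by simp⟩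
    | mul g h _ _ ihg ihh =>
      obtain ⟨k, hk⟩ := ihg
      obtain ⟨l, hl⟩ := ihh
      exact ⟨k + l, by simp [hk, hl]⟩
    | inv g _ ih =>
      obtain ⟨k, hk⟩ := ih
      exact ⟨-k, by simp [hk]⟩
  obtain ⟨g, hg⟩ := hφ (.sr 0)
  obtain ⟨k, hk⟩ := hrot g
  rw [hg] at hk
  cases hk

theorem exists_monoidHom_fours {G : Type*} [Group G] (g h : G)
    (hg : h⁻¹ * g ^ 2 * h * g ^ 2 = 1) (hh : g⁻¹ * h ^ 2 * g * h ^ 2 = 1) :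
    ∃ φ : Fours →* G, φ fx = g ∧ φ fy = h := by
  have hrels : ∀ r ∈ foursRels, FreeGroup.lift ![g, h] r = 1 := by
    rintro _ (rfl | rfl) <;> simpa
  exact ⟨PresentedGroup.toGroup hrels, PresentedGroup.toGroup.of hrels,
    PresentedGroup.toGroup.of hrels⟩


/-- Each of `N₁, N₂, N₃` is normal in `Γ`; every surjective homomorphism `Γ → D∞` has
kernel one of `N₁, N₂, N₃`; and conversely each `Nᵢ` is the kernel of some surjective
homomorphism `Γ → D∞`. -/
theorem dihedral_kernels :
    N₁.Normal ∧ N₂.Normal ∧ N₃.Normal ∧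
    (∀ φ : Fours →* DihedralGroup 0, Function.Surjective φ →
      φ.ker = N₁ ∨ φ.ker = N₂ ∨ φ.ker = N₃) ∧
    (∃ φ : Fours →* DihedralGroup 0, Function.Surjective φ ∧ φ.ker = N₁) ∧
    (∃ φ : Fours →* DihedralGroup 0, Function.Surjective φ ∧ φ.ker = N₂) ∧
    (∃ φ : Fours →* DihedralGroup 0, Function.Surjective φ ∧ φ.ker = N₃) := by
  refine ⟨N₁_normal, N₂_normal, N₃_normal, fun φ hφ ↦ ?_, ?_, ?_, ?_⟩
  · rcases hx : φ fx with i | i <;> rcases hy : φ fy with j | j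
    · exact absurd hφ (not_surjective_of_map_eq_r hx hy)
    · exact .inr (.inr (ker_eq_N₃ hφ hx hy))
    · exact .inr (.inl (ker_eq_N₂ hφ hx hy))
    · exact .inl (ker_eq_N₁ hφ hx hy)
  · obtain ⟨φ, hx, hy⟩ := exists_monoidHom_fours (DihedralGroup.sr (0 : ZMod 0)) (.sr 1)
      (by simp [pow_two]) (by simp [pow_two])
    have hφ : Function.Surjective φ := surjective_of_r_one_mem_range_of_sr_mem_range φ
      ⟨fx * fy, by simp [hx, hy]⟩ ⟨fx, hx⟩
    exact ⟨φ, hφ, ker_eq_N₁ hφ hx hy⟩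
  · obtain ⟨φ, hx, hy⟩ := exists_monoidHom_fours (DihedralGroup.sr (0 : ZMod 0)) (.r 1)
      (by simp [pow_two]) (by simp [pow_two])
    have hφ : Function.Surjective φ := surjective_of_r_one_mem_range_of_sr_mem_range φ
      ⟨fy, hy⟩ ⟨fx, hx⟩
    exact ⟨φ, hφ, ker_eq_N₂ hφ hx hy⟩
  · obtain ⟨φ, hx, hy⟩ := exists_monoidHom_fours (DihedralGroup.r (1 : ZMod 0)) (.sr 0)
      (by simp [pow_two]) (by simp [pow_two])
    have hφ : Function.Surjective φ := surjective_of_r_one_mem_range_of_sr_mem_range φ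
      ⟨fx, hx⟩ ⟨fy, hy⟩
    exact ⟨φ, hφ, ker_eq_N₃ hφ hx hy⟩
end

section
/- For every ordered pair (u, v) of distinct elements of {x, y, xy}, there exists a group automorphism of Γ sending x to u and y to v. In particular, there is an automorphism ψ of Γ with ψ(N₁) = N₂, ψ(N₂) = N₃ and ψ(N₃) = N₁. -/
theorem fx_sq_conj : fy⁻¹ * fx ^ 2 * fy * fx ^ 2 = 1 :=
  PresentedGroup.one_of_mem (rels := foursRels) (Or.inl rfl)

theorem fy_sq_conj : fx⁻¹ * fy ^ 2 * fx * fy ^ 2 = 1 :=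
  PresentedGroup.one_of_mem (rels := foursRels) (Or.inr rfl)

section Relations

variable {G : Type*} [Group G] {u v : G}

theorem conj_sq_mul (hu : v⁻¹ * u ^ 2 * v * u ^ 2 = 1) :
    (u * v)⁻¹ * u ^ 2 * (u * v) * u ^ 2 = 1 := by
  rw [← hu]; group

theorem mul_sq_conj (hu : v⁻¹ * u ^ 2 * v * u ^ 2 = 1) (hv : u⁻¹ * v ^ 2 * u * v ^ 2 = 1) :
    u⁻¹ * (u * v) ^ 2 * u * (u * v) ^ 2 = 1 := by
  have h₁ : v * u ^ 2 = (v⁻¹ * u ^ 2)⁻¹ := eq_inv_of_mul_eq_one_right (by rw [← hu]; group)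
  have h₂ : u⁻¹ * v ^ 2 * u = (v ^ 2)⁻¹ := eq_inv_of_mul_eq_one_left hv
  calc u⁻¹ * (u * v) ^ 2 * u * (u * v) ^ 2 = v * u * (v * u ^ 2) * v * u * v := by
        simp only [pow_two]; group
    _ = v * (u⁻¹ * v ^ 2 * u) * v := by rw [h₁]; simp only [pow_two]; group
    _ = 1 := by rw [h₂]; group

theorem conj_sq_inv_mul (hu : v⁻¹ * u ^ 2 * v * u ^ 2 = 1) :
    (u⁻¹ * v)⁻¹ * u ^ 2 * (u⁻¹ * v) * u ^ 2 = 1 := by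
  rw [← hu]; group

theorem inv_mul_sq_conj (hu : v⁻¹ * u ^ 2 * v * u ^ 2 = 1) (hv : u⁻¹ * v ^ 2 * u * v ^ 2 = 1) :
    u⁻¹ * (u⁻¹ * v) ^ 2 * u * (u⁻¹ * v) ^ 2 = 1 := by
  have h₁ : v⁻¹ * u ^ 2 * v = (u ^ 2)⁻¹ := eq_inv_of_mul_eq_one_left hu
  have h₂ : u⁻¹ * v ^ 2 * u = (v ^ 2)⁻¹ := eq_inv_of_mul_eq_one_left hv
  calc u⁻¹ * (u⁻¹ * v) ^ 2 * u * (u⁻¹ * v) ^ 2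
      = (u ^ 2)⁻¹ * v * (u⁻¹ * v ^ 2 * u) * (u ^ 2)⁻¹ * v := by
        simp only [pow_two]; group
    _ = (u ^ 2)⁻¹ * (v⁻¹ * u ^ 2 * v)⁻¹ := by rw [h₂]; group
    _ = 1 := by rw [h₁]; group

/-- The homomorphism out of `Γ` sending `x` to `u` and `y` to `v`. -/
def foursLift (u v : G) (hu : v⁻¹ * u ^ 2 * v * u ^ 2 = 1)
    (hv : u⁻¹ * v ^ 2 * u * v ^ 2 = 1) : Fours →* G :=
  PresentedGroup.toGroup (f := ![u, v]) (by
    rintro r (rfl | rfl)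
    · simpa using hu
    · simpa using hv)

@[simp]
theorem foursLift_fx (hu : v⁻¹ * u ^ 2 * v * u ^ 2 = 1) (hv : u⁻¹ * v ^ 2 * u * v ^ 2 = 1) :
    foursLift u v hu hv fx = u :=
  PresentedGroup.toGroup.of _

@[simp]
theorem foursLift_fy (hu : v⁻¹ * u ^ 2 * v * u ^ 2 = 1) (hv : u⁻¹ * v ^ 2 * u * v ^ 2 = 1) :
    foursLift u v hu hv fy = v :=
  PresentedGroup.toGroup.of _

theorem fours_hom_ext {f g : Fours →* G} (hx : f fx = g fx) (hy : f fy = g fy) : f = g :=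
  PresentedGroup.ext (Fin.forall_fin_two.2 ⟨hx, hy⟩)

end Relations

/-- The automorphism of `Γ` exchanging `x` and `y`. -/
def foursSwap : Fours ≃* Fours :=
  MonoidHom.toMulEquiv (foursLift fy fx fy_sq_conj fx_sq_conj)
    (foursLift fy fx fy_sq_conj fx_sq_conj)
    (fours_hom_ext (by simp) (by simp)) (fours_hom_ext (by simp) (by simp))

@[simp]
theorem foursSwap_fx : foursSwap fx = fy :=
  foursLift_fx fy_sq_conj fx_sq_conj

@[simp]
theorem foursSwap_fy : foursSwap fy = fx :=
  foursLift_fy fy_sq_conj fx_sq_conj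

/-- The automorphism of `Γ` fixing `x` and sending `y` to `xy`. -/
def foursShear : Fours ≃* Fours :=
  MonoidHom.toMulEquiv
    (foursLift fx (fx * fy) (conj_sq_mul fx_sq_conj) (mul_sq_conj fx_sq_conj fy_sq_conj))
    (foursLift fx (fx⁻¹ * fy) (conj_sq_inv_mul fx_sq_conj)
      (inv_mul_sq_conj fx_sq_conj fy_sq_conj))
    (fours_hom_ext (by simp) (by simp)) (fours_hom_ext (by simp) (by simp))

@[simp]
theorem foursShear_fx : foursShear fx = fx :=
  foursLift_fx (conj_sq_mul fx_sq_conj) (mul_sq_conj fx_sq_conj fy_sq_conj)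

@[simp]
theorem foursShear_fy : foursShear fy = fx * fy :=
  foursLift_fy (conj_sq_mul fx_sq_conj) (mul_sq_conj fx_sq_conj fy_sq_conj)

theorem fx_mul_fy_mul_fx_sq : (fx * fy * fx) ^ 2 = (fy ^ 2)⁻¹ := by
  have h₁ : fy * fx ^ 2 = (fy⁻¹ * fx ^ 2)⁻¹ :=
    eq_inv_of_mul_eq_one_right (by rw [← fx_sq_conj]; group)
  calc (fx * fy * fx) ^ 2 = fx * (fy * fx ^ 2) * fy * fx := by simp only [pow_two]; group
    _ = fx⁻¹ * fy ^ 2 * fx := by rw [h₁]; simp only [pow_two]; group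
    _ = (fy ^ 2)⁻¹ := eq_inv_of_mul_eq_one_left fy_sq_conj

theorem Subgroup.closure_pair_inv {G : Type*} [Group G] (g h : G) :
    Subgroup.closure {g, h⁻¹} = Subgroup.closure {g, h} := by
  simp only [Set.insert_eq, Subgroup.closure_union, ← Set.inv_singleton, Subgroup.closure_inv]

/-- For every ordered pair `(u, v)` of distinct elements of `{x, y, xy}` there is an
automorphism of `Γ` with `x ↦ u`, `y ↦ v`; in particular some automorphism `ψ` cyclically
permutes `N₁, N₂, N₃`. -/
theorem exists_automorphisms :
    (∀ u v : Fours, u ∈ ({fx, fy, fx * fy} : Set Fours) →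
      v ∈ ({fx, fy, fx * fy} : Set Fours) → u ≠ v →
      ∃ ψ : Fours ≃* Fours, ψ fx = u ∧ ψ fy = v) ∧
    (∃ ψ : Fours ≃* Fours,
      N₁.map ψ.toMonoidHom = N₂ ∧ N₂.map ψ.toMonoidHom = N₃ ∧
      N₃.map ψ.toMonoidHom = N₁) := by
  refine ⟨?_, foursSwap.trans foursShear, ?_, ?_, ?_⟩
  · rintro u v (rfl | rfl | rfl) (rfl | rfl | rfl) huv
    · exact absurd rfl huv
    · exact ⟨MulEquiv.refl _, rfl, rfl⟩
    · exact ⟨foursShear, by simp, by simp⟩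
    · exact ⟨foursSwap, by simp, by simp⟩
    · exact absurd rfl huv
    · exact ⟨(foursShear.trans foursSwap).trans (MulAut.conj fy⁻¹), by simp, by simp⟩
    · exact ⟨foursSwap.trans foursShear, by simp, by simp⟩
    · exact ⟨foursSwap.trans ((foursShear.trans foursSwap).trans (MulAut.conj fy⁻¹)),
        by simp, by simp⟩
    · exact absurd rfl huv
  · simp [N₁, N₂, MonoidHom.map_closure, Set.image_pair, fa, fb, fc, Set.pair_comm]
  · rw [N₃, Set.pair_comm]
    simp [N₂, MonoidHom.map_closure, Set.image_pair, fa, fb, fc, fx_mul_fy_mul_fx_sq,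
      Subgroup.closure_pair_inv]
  · simp [N₁, N₃, MonoidHom.map_closure, Set.image_pair, fa, fb, fc, fx_mul_fy_mul_fx_sq,
      Subgroup.closure_pair_inv]
end

section
/- Let α₁, α₂, α₃, β₁, β₂, β₃ ∈ R be such that αᵢ and βᵢ are relatively prime (every common divisor of αᵢ and βᵢ is a unit) for each i = 1, 2, 3. Let p ∈ R be a prime element dividing each of the six elements β₃·φ_x(β₂)·φ_x(φ_y(β₁)), α₃·β₂·φ_y(β₁), β₃·φ_x(β₂)·φ_x(φ_y(α₁)), α₃·β₂·φ_y(α₁), α₃·α₂·β₁ + β₃·φ_x(α₂)·φ_x(α₁), and α₃·α₂·α₁ + β₃·φ_x(α₂)·φ_x(β₁)·a. Then p divides β₂ and φ_x(β₂), and p divides none of α₂, φ_x(α₂), α₃, β₃. -/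
open MonoidAlgebra

/-- The Laurent polynomial ring `K[a^{±1}, b^{±1}]`, realized as the group algebra
of `ℤ²` over `K`. -/
abbrev LaurentTwo (K : Type*) [Field K] : Type _ :=
  MonoidAlgebra K (Multiplicative (ℤ × ℤ))

/-- The generator `a`. -/
noncomputable def genA (K : Type*) [Field K] : LaurentTwo K :=
  MonoidAlgebra.of K (Multiplicative (ℤ × ℤ)) (Multiplicative.ofAdd (1, 0))

/-- The generator `b`. -/
noncomputable def genB (K : Type*) [Field K] : LaurentTwo K :=
  MonoidAlgebra.of K (Multiplicative (ℤ × ℤ)) (Multiplicative.ofAdd (0, 1))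

/-- The `K`-algebra automorphism `φ_x` of `K[a^{±1}, b^{±1}]` with
`φ_x(a) = a`, `φ_x(b) = b⁻¹` (conjugation by `x`). -/
noncomputable def phiX (K : Type*) [Field K] : LaurentTwo K ≃ₐ[K] LaurentTwo K :=
  MonoidAlgebra.domCongr K K
    (AddEquiv.toMultiplicative ((AddEquiv.refl ℤ).prodCongr (AddEquiv.neg ℤ)))

/-- The `K`-algebra automorphism `φ_y` of `K[a^{±1}, b^{±1}]` with
`φ_y(a) = a⁻¹`, `φ_y(b) = b` (conjugation by `y`). -/
noncomputable def phiY (K : Type*) [Field K] : LaurentTwo K ≃ₐ[K] LaurentTwo K :=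
  MonoidAlgebra.domCongr K K
    (AddEquiv.toMultiplicative ((AddEquiv.neg ℤ).prodCongr (AddEquiv.refl ℤ)))


/-- The generator `a` is a unit. -/
theorem isUnit_genA (K : Type*) [Field K] : IsUnit (genA K) :=
  (Group.isUnit (Multiplicative.ofAdd ((1, 0) : ℤ × ℤ))).map
    (MonoidAlgebra.of K (Multiplicative (ℤ × ℤ)))

/-- The images of two relatively prime elements under a multiplicative automorphism have no
common prime divisor. -/
theorem Prime.not_dvd_map_of_dvd_map {M : Type*} [CommMonoidWithZero M] {p α β : M}
    (hp : Prime p) (h : ∀ d : M, d ∣ α → d ∣ β → IsUnit d) (e : M ≃* M)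
    (hα : p ∣ e α) : ¬ p ∣ e β := by
  intro hβ
  refine hp.not_isUnit ((MulEquiv.isUnit_map e.symm).mp (h _ ?_ ?_))
  · simpa using map_dvd e.symm hα
  · simpa using map_dvd e.symm hβ

/-- If `αᵢ, βᵢ` are pairwise coprime pairs and `p` is a prime dividing each of the six
coefficients of the expanded product `(α₃+β₃x)(α₂+β₂y)(α₁+β₁x)`, then `p` divides `β₂`
and `φ_x(β₂)`, and `p` divides none of `α₂`, `φ_x(α₂)`, `α₃`, `β₃`. -/
theorem prime_divides_beta2 {K : Type*} [Field K]
    (α₁ α₂ α₃ β₁ β₂ β₃ p : LaurentTwo K)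
    (h₁ : ∀ d : LaurentTwo K, d ∣ α₁ → d ∣ β₁ → IsUnit d)
    (h₂ : ∀ d : LaurentTwo K, d ∣ α₂ → d ∣ β₂ → IsUnit d)
    (h₃ : ∀ d : LaurentTwo K, d ∣ α₃ → d ∣ β₃ → IsUnit d)
    (hp : Prime p)
    (hd₁ : p ∣ β₃ * phiX K β₂ * phiX K (phiY K β₁))
    (hd₂ : p ∣ α₃ * β₂ * phiY K β₁)
    (hd₃ : p ∣ β₃ * phiX K β₂ * phiX K (phiY K α₁))
    (hd₄ : p ∣ α₃ * β₂ * phiY K α₁)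
    (hd₅ : p ∣ α₃ * α₂ * β₁ + β₃ * phiX K α₂ * phiX K α₁)
    (hd₆ : p ∣ α₃ * α₂ * α₁ + β₃ * phiX K α₂ * phiX K β₁ * genA K) :
    (p ∣ β₂ ∧ p ∣ phiX K β₂) ∧
      ¬ p ∣ α₂ ∧ ¬ p ∣ phiX K α₂ ∧ ¬ p ∣ α₃ ∧ ¬ p ∣ β₃ := by
  have n₁ := hp.not_dvd_map_of_dvd_map h₁ (MulEquiv.refl _)
  have n₁x := hp.not_dvd_map_of_dvd_map h₁ (phiX K : LaurentTwo K ≃* LaurentTwo K)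
  have n₁y := hp.not_dvd_map_of_dvd_map h₁ (phiY K : LaurentTwo K ≃* LaurentTwo K)
  have n₁yx := hp.not_dvd_map_of_dvd_map h₁
    ((phiY K : LaurentTwo K ≃* LaurentTwo K).trans (phiX K : LaurentTwo K ≃* LaurentTwo K))
  have n₂ := hp.not_dvd_map_of_dvd_map h₂ (MulEquiv.refl _)
  have n₂x := hp.not_dvd_map_of_dvd_map h₂ (phiX K : LaurentTwo K ≃* LaurentTwo K)
  have n₃ := hp.not_dvd_map_of_dvd_map h₃ (MulEquiv.refl _)
  change p ∣ α₁ → ¬ p ∣ β₁ at n₁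
  change p ∣ phiX K α₁ → ¬ p ∣ phiX K β₁ at n₁x
  change p ∣ phiY K α₁ → ¬ p ∣ phiY K β₁ at n₁y
  change p ∣ phiX K (phiY K α₁) → ¬ p ∣ phiX K (phiY K β₁) at n₁yx
  change p ∣ α₂ → ¬ p ∣ β₂ at n₂
  change p ∣ phiX K α₂ → ¬ p ∣ phiX K β₂ at n₂x
  change p ∣ α₃ → ¬ p ∣ β₃ at n₃
  have ha : ¬ p ∣ genA K := fun h => hp.not_isUnit (isUnit_of_dvd_unit h (isUnit_genA K))
  have hβ₃xβ₂ : p ∣ β₃ ∨ p ∣ phiX K β₂ := by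
    rw [← hp.dvd_mul]
    by_contra h
    exact n₁yx ((hp.dvd_or_dvd hd₃).resolve_left h) ((hp.dvd_or_dvd hd₁).resolve_left h)
  have hα₃β₂ : p ∣ α₃ ∨ p ∣ β₂ := by
    rw [← hp.dvd_mul]
    by_contra h
    exact n₁y ((hp.dvd_or_dvd hd₄).resolve_left h) ((hp.dvd_or_dvd hd₂).resolve_left h)
  have hα₃ : ¬ p ∣ α₃ := by
    intro h
    have hxβ₂ := hβ₃xβ₂.resolve_left (n₃ h)
    have hβ₃xα₂ : ¬ p ∣ β₃ * phiX K α₂ := fun h' =>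
      (hp.dvd_or_dvd h').elim (n₃ h) fun h'' => n₂x h'' hxβ₂
    rw [dvd_add_right ((h.mul_right _).mul_right _)] at hd₅ hd₆
    exact n₁x ((hp.dvd_or_dvd hd₅).resolve_left hβ₃xα₂)
      ((hp.dvd_or_dvd ((hp.dvd_or_dvd hd₆).resolve_right ha)).resolve_left hβ₃xα₂)
  have hβ₂ := hα₃β₂.resolve_left hα₃
  have hα₂ : ¬ p ∣ α₂ := fun h => n₂ h hβ₂
  have hβ₃ : ¬ p ∣ β₃ := by
    intro h
    have hα₃α₂ : ¬ p ∣ α₃ * α₂ := hp.not_dvd_mul hα₃ hα₂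
    rw [dvd_add_left ((h.mul_right _).mul_right _)] at hd₅
    rw [dvd_add_left (((h.mul_right _).mul_right _).mul_right _)] at hd₆
    exact n₁ ((hp.dvd_or_dvd hd₆).resolve_left hα₃α₂) ((hp.dvd_or_dvd hd₅).resolve_left hα₃α₂)
  have hxβ₂ := hβ₃xβ₂.resolve_left hβ₃
  exact ⟨⟨hβ₂, hxβ₂⟩, hα₂, fun h => n₂x h hxβ₂, hα₃, hβ₃⟩
end

section
/- If α, β ∈ R are such that α·φ_y(α) − β·φ_y(β)·b is a unit of R, then α = 0 or β = 0. -/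
open MonoidAlgebra

/-- `HasTopDegree D f d` says that `d` is the largest value of `D` on the support of `f`. -/
def HasTopDegree {R G : Type*} [Semiring R] (D : G → ℤ) (f : MonoidAlgebra R G) (d : ℤ) : Prop :=
  IsGreatest (D '' (f.coeff.support : Set G)) d

theorem exists_hasTopDegree {R G : Type*} [Semiring R] (D : G → ℤ) {f : MonoidAlgebra R G}
    (hf : f ≠ 0) : ∃ d, HasTopDegree D f d := by
  classical
  have hne : (f.coeff.support.image D).Nonempty := by
    rw [Finset.image_nonempty, Finsupp.support_nonempty_iff]
    simpa using hf
  refine ⟨(f.coeff.support.image D).max' hne, ?_⟩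
  rw [HasTopDegree, ← Finset.coe_image]
  exact Finset.isGreatest_max' _ hne

theorem HasTopDegree.neg_le {R G : Type*} [Semiring R] {D : G → ℤ} {f : MonoidAlgebra R G}
    {d e : ℤ} (hd : HasTopDegree D f d) (he : HasTopDegree (fun x ↦ -D x) f e) : -e ≤ d := by
  obtain ⟨x, hx, rfl⟩ := hd.1
  linarith [he.2 ⟨x, hx, rfl⟩]

theorem HasTopDegree.mul {R G : Type*} [Semiring R] [NoZeroDivisors R] [Mul G] [UniqueProds G]
    {D : G → ℤ} (hD : ∀ x y, D (x * y) = D x + D y) {f g : MonoidAlgebra R G} {d e : ℤ}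
    (hf : HasTopDegree D f d) (hg : HasTopDegree D g e) : HasTopDegree D (f * g) (d + e) := by
  classical
  obtain ⟨⟨x, hx, hxd⟩, hf⟩ := hf
  obtain ⟨⟨y, hy, hye⟩, hg⟩ := hg
  constructor
  · obtain ⟨x₀, hx₀, y₀, hy₀, huniq⟩ := UniqueProds.uniqueMul_of_nonempty
      (A := f.coeff.support.filter (D · = d)) (B := g.coeff.support.filter (D · = e))
      ⟨x, Finset.mem_filter.2 ⟨hx, hxd⟩⟩ ⟨y, Finset.mem_filter.2 ⟨hy, hye⟩⟩
    rw [Finset.mem_filter] at hx₀ hy₀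
    have huniq' : UniqueMul f.coeff.support g.coeff.support x₀ y₀ := by
      intro u v hu hv huv
      have hle₁ := hf ⟨u, hu, rfl⟩
      have hle₂ := hg ⟨v, hv, rfl⟩
      have hdeg : D u + D v = d + e := by rw [← hD, huv, hD, hx₀.2, hy₀.2]
      exact huniq (Finset.mem_filter.2 ⟨hu, by linarith⟩) (Finset.mem_filter.2 ⟨hv, by linarith⟩) huv
    refine ⟨x₀ * y₀, ?_, by rw [hD, hx₀.2, hy₀.2]⟩
    rw [Finset.mem_coe, Finsupp.mem_support_iff, coeff_mul_mul_of_uniqueMul huniq']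
    exact mul_ne_zero (Finsupp.mem_support_iff.1 hx₀.1) (Finsupp.mem_support_iff.1 hy₀.1)
  · rintro _ ⟨z, hz, rfl⟩
    obtain ⟨u, hu, v, hv, rfl⟩ := Finset.mem_mul.1 (support_coeff_mul_subset f g hz)
    rw [hD]
    exact add_le_add (hf ⟨u, hu, rfl⟩) (hg ⟨v, hv, rfl⟩)

theorem HasTopDegree.sub {R G : Type*} [Ring R] {D : G → ℤ} {f g : MonoidAlgebra R G} {d e : ℤ}
    (hf : HasTopDegree D f d) (hg : HasTopDegree D g e) (hde : d ≠ e) :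
    HasTopDegree D (f - g) (max d e) := by
  classical
  obtain ⟨⟨x, hx, rfl⟩, hf⟩ := hf
  obtain ⟨⟨y, hy, rfl⟩, hg⟩ := hg
  constructor
  · rcases hde.lt_or_gt with hlt | hlt
    · refine ⟨y, ?_, (max_eq_right hlt.le).symm⟩
      have hfy : f.coeff y = 0 := by
        by_contra hne
        exact hlt.not_ge (hf ⟨y, Finsupp.mem_support_iff.2 hne, rfl⟩)
      simpa [hfy] using hy
    · refine ⟨x, ?_, (max_eq_left hlt.le).symm⟩
      have hgx : g.coeff x = 0 := by
        by_contra hne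
        exact hlt.not_ge (hg ⟨x, Finsupp.mem_support_iff.2 hne, rfl⟩)
      simpa [hgx] using hx
  · rintro _ ⟨z, hz, rfl⟩
    rcases Finset.mem_union.1 (Finsupp.support_sub hz) with hz | hz
    · exact le_max_of_le_left (hf ⟨z, hz, rfl⟩)
    · exact le_max_of_le_right (hg ⟨z, hz, rfl⟩)

theorem HasTopDegree.domCongr {R G : Type*} [CommSemiring R] [Monoid G] {D : G → ℤ} {e : G ≃* G}
    (he : ∀ x, D (e x) = D x) {f : MonoidAlgebra R G} {d : ℤ} (hf : HasTopDegree D f d) :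
    HasTopDegree D (MonoidAlgebra.domCongr R R e f) d := by
  have himage : D '' ((MonoidAlgebra.domCongr R R e f).coeff.support : Set G) =
      D '' (f.coeff.support : Set G) := by
    rw [MonoidAlgebra.domCongr_support, Finset.coe_map, Set.image_image]
    exact Set.image_congr fun x _ ↦ he x
  rwa [HasTopDegree, himage]

theorem hasTopDegree_of {R G : Type*} [Semiring R] [Nontrivial R] [MulOneClass G] (D : G → ℤ)
    (x : G) : HasTopDegree D (MonoidAlgebra.of R G x) (D x) := by
  rw [HasTopDegree, MonoidAlgebra.of_apply, coeff_single, Finsupp.support_single _ one_ne_zero]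
  simp

/-- For a degree that `φ_y` preserves and that is odd on `b`, the two terms of the twisted norm
form have top degrees of different parity, so they cannot cancel. -/
theorem hasTopDegree_norm_sub {K : Type*} [Field K] {D : Multiplicative (ℤ × ℤ) → ℤ}
    (hD : ∀ x y, D (x * y) = D x + D y)
    (hinv : ∀ i j : ℤ, D (Multiplicative.ofAdd (-i, j)) = D (Multiplicative.ofAdd (i, j)))
    (hodd : Odd (D (Multiplicative.ofAdd (0, 1)))) {α β : LaurentTwo K} {p q : ℤ}
    (hα : HasTopDegree D α p) (hβ : HasTopDegree D β q) :
    HasTopDegree D (α * phiY K α - β * phiY K β * genB K)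
      (max (p + p) (q + q + D (Multiplicative.ofAdd (0, 1)))) := by
  have hphi {f : LaurentTwo K} {d : ℤ} (hf : HasTopDegree D f d) : HasTopDegree D (phiY K f) d :=
    hf.domCongr fun x ↦ hinv x.toAdd.1 x.toAdd.2
  refine (hα.mul hD (hphi hα)).sub
    ((hβ.mul hD (hphi hβ)).mul hD (hasTopDegree_of D _)) ?_
  obtain ⟨k, hk⟩ := hodd
  omega

/-- If `α·φ_y(α) − β·φ_y(β)·b` is a unit of `R = K[a^{±1}, b^{±1}]`,
then `α = 0` or `β = 0`. -/
theorem zero_if_unit {K : Type*} [Field K] (α β : LaurentTwo K)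
    (h : IsUnit (α * phiY K α - β * phiY K β * genB K)) :
    α = 0 ∨ β = 0 := by
  by_contra! hne
  obtain ⟨v, huv⟩ := h.exists_right_inv
  have hv : v ≠ 0 := by
    rintro rfl
    simp at huv
  let D : Multiplicative (ℤ × ℤ) → ℤ := fun x ↦ x.toAdd.2
  let E : Multiplicative (ℤ × ℤ) → ℤ := fun x ↦ -D x
  have hD : ∀ x y, D (x * y) = D x + D y := fun _ _ ↦ rfl
  have hE : ∀ x y, E (x * y) = E x + E y := fun _ _ ↦ neg_add _ _
  obtain ⟨p, hp⟩ := exists_hasTopDegree D hne.1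
  obtain ⟨q, hq⟩ := exists_hasTopDegree D hne.2
  obtain ⟨r, hr⟩ := exists_hasTopDegree D hv
  obtain ⟨p', hp'⟩ := exists_hasTopDegree E hne.1
  obtain ⟨q', hq'⟩ := exists_hasTopDegree E hne.2
  obtain ⟨r', hr'⟩ := exists_hasTopDegree E hv
  have hDb : D (Multiplicative.ofAdd (0, 1)) = 1 := rfl
  have hEb : E (Multiplicative.ofAdd (0, 1)) = -1 := rfl
  have htop := (hasTopDegree_norm_sub hD (fun _ _ ↦ rfl) (by decide) hp hq).mul hD hr
  have hbot := (hasTopDegree_norm_sub hE (fun _ _ ↦ rfl) (by decide) hp' hq').mul hE hr'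
  rw [huv, ← map_one (MonoidAlgebra.of K _)] at htop hbot
  have htop := htop.unique (hasTopDegree_of D 1)
  have hbot := hbot.unique (hasTopDegree_of E 1)
  have hD1 : D 1 = 0 := rfl
  have hE1 : E 1 = 0 := rfl
  have hpp := hp.neg_le hp'
  have hqq := hq.neg_le hq'
  have hrr := hr.neg_le hr'
  omega
end

section
/- Let α, β ∈ R be relatively prime (every common divisor of α and β is a unit) and set D = α·φ_y(α) − β·φ_y(β)·b. Then for every d ∈ R, d divides both D and β if and only if d divides both φ_y(α) and β; in particular the greatest common divisors of (D, β) and of (φ_y(α), β) are associates. -/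
open MonoidAlgebra

open scoped LaurentPolynomial in
/-- Laurent polynomials over a unique factorization domain form a unique factorization domain. -/
theorem LaurentPolynomial.uniqueFactorizationMonoid (R : Type*) [CommRing R] [IsDomain R]
    [UniqueFactorizationMonoid R] : UniqueFactorizationMonoid R[T;T⁻¹] :=
  UniqueFactorizationMonoid.of_isLocalization (Submonoid.powers (Polynomial.X : Polynomial R)) _

/-- The two-variable Laurent polynomial ring over a field is a unique factorization domain. -/
theorem LaurentTwo.uniqueFactorizationMonoid (K : Type*) [Field K] :
    UniqueFactorizationMonoid (LaurentTwo K) := by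
  have hK : UniqueFactorizationMonoid (LaurentPolynomial K) :=
    LaurentPolynomial.uniqueFactorizationMonoid K
  have : IsDomain (LaurentPolynomial K) := NoZeroDivisors.to_isDomain _
  let e : LaurentTwo K ≃* LaurentPolynomial (LaurentPolynomial K) :=
    ((AddMonoidAlgebra.toMultiplicative K (ℤ × ℤ)).symm.trans
      AddMonoidAlgebra.curryRingEquiv).toMulEquiv
  exact e.symm.uniqueFactorizationMonoid
    (LaurentPolynomial.uniqueFactorizationMonoid (LaurentPolynomial K))

/-- If `α` and `β` are relatively prime and `D = α·φ_y(α) − β·φ_y(β)·b`, then an element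
divides both `D` and `β` if and only if it divides both `φ_y(α)` and `β`. -/
theorem dvd_D_and_beta_iff {K : Type*} [Field K] (α β : LaurentTwo K)
    (hcop : ∀ d : LaurentTwo K, d ∣ α → d ∣ β → IsUnit d) :
    ∀ d : LaurentTwo K,
      (d ∣ (α * phiY K α - β * phiY K β * genB K) ∧ d ∣ β) ↔ (d ∣ phiY K α ∧ d ∣ β) := by
  have := LaurentTwo.uniqueFactorizationMonoid K
  intro d
  refine and_congr_left fun hβ => ?_
  have hrel : IsRelPrime d α := fun c hcd hcα => hcop c hcα (hcd.trans hβ)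
  rw [dvd_sub_left ((hβ.mul_right _).mul_right _)]
  exact ⟨hrel.dvd_of_dvd_mul_left, fun h => h.mul_left α⟩
end

section
/- The subgroup H = ⟨x², y², (xy)²⟩ is a normal subgroup of Γ, H is isomorphic to ℤ³ (free abelian of rank 3), the quotient Γ/H is isomorphic to the Klein four group ℤ/2ℤ × ℤ/2ℤ, and {1, x, y, xy} is a complete set of coset representatives for H in Γ. -/
/-- The subgroup `H = ⟨x², y², (xy)²⟩` of `Γ`. -/
def foursH : Subgroup Fours := Subgroup.closure {fa, fb, fc}

/-- `y²` is inverted by `x`. -/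
theorem semiconjBy_fx_fb : SemiconjBy fx fb fb⁻¹ := by
  have h : fx⁻¹ * fy ^ 2 * fx * fy ^ 2 = 1 :=
    PresentedGroup.one_of_mem (rels := foursRels) (Or.inr rfl)
  rw [SemiconjBy, eq_inv_mul_iff_mul_eq, fb]
  calc fy ^ 2 * (fx * fy ^ 2) = fx * (fx⁻¹ * fy ^ 2 * fx * fy ^ 2) := by group
    _ = fx := by rw [h, mul_one]

/-- `x²` is inverted by `y`. -/
theorem semiconjBy_fy_fa : SemiconjBy fy fa fa⁻¹ := by
  have h : fy⁻¹ * fx ^ 2 * fy * fx ^ 2 = 1 :=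
    PresentedGroup.one_of_mem (rels := foursRels) (Or.inl rfl)
  rw [SemiconjBy, eq_inv_mul_iff_mul_eq, fa]
  calc fx ^ 2 * (fy * fx ^ 2) = fy * (fy⁻¹ * fx ^ 2 * fy * fx ^ 2) := by group
    _ = fy := by rw [h, mul_one]

theorem commute_fx_fa : Commute fx fa := Commute.self_pow fx 2

theorem commute_fy_fb : Commute fy fb := Commute.self_pow fy 2

/-- `(xy)²` is inverted by `x`. -/
theorem semiconjBy_fx_fc : SemiconjBy fx fc fc⁻¹ := by
  have h : fx * fb⁻¹ = fb * fx := by simpa using semiconjBy_fx_fb.inv_right.eq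
  rw [SemiconjBy, eq_inv_mul_iff_mul_eq]
  calc fc * (fx * fc) = fx * fy * fx * (fy * fa) * fy * fx * fy := by
        simp only [fc, fa, pow_two]; group
    _ = fx * fy * fx⁻¹ * (fb * fx) * fy := by
        rw [semiconjBy_fy_fa.eq]; simp only [fb, fa, pow_two]; group
    _ = fx := by
        rw [← h, fb]; group

/-- `(xy)²` is inverted by `y`. -/
theorem semiconjBy_fy_fc : SemiconjBy fy fc fc⁻¹ := by
  have h : SemiconjBy fx⁻¹ fc fc⁻¹ := by
    simpa using semiconjBy_fx_fc.inv_right.inv_symm_left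
  have h' : SemiconjBy (fx * fy) fc fc := Commute.self_pow (fx * fy) 2
  simpa using h.mul_left h'

theorem SemiconjBy.commute_sq_of_inv {G : Type*} [Group G] {g h : G} (hg : SemiconjBy g h h⁻¹) :
    Commute (g ^ 2) h := by
  have h' : SemiconjBy g h⁻¹ h := by simpa using hg.inv_right
  exact pow_two g ▸ h'.mul_left hg

theorem commute_fa_fb : Commute fa fb := semiconjBy_fx_fb.commute_sq_of_inv

theorem commute_fa_fc : Commute fa fc := semiconjBy_fx_fc.commute_sq_of_inv

theorem commute_fb_fc : Commute fb fc := semiconjBy_fy_fc.commute_sq_of_inv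

theorem fy_mul_fx : fy * fx = fc⁻¹ * fa⁻¹ * fb * (fx * fy) := by
  have h : fx * fb⁻¹ = fb * fx := by simpa using semiconjBy_fx_fb.inv_right.eq
  have h' : fx⁻¹ * fc = fc⁻¹ * fx⁻¹ := by
    simpa using semiconjBy_fx_fc.inv_right.inv_symm_left.eq
  calc fy * fx = fx⁻¹ * fc * fy⁻¹ := by simp only [fc, pow_two]; group
    _ = fc⁻¹ * fa⁻¹ * (fx * fb⁻¹) * fy := by rw [h', fa, fb]; group
    _ = fc⁻¹ * fa⁻¹ * fb * (fx * fy) := by rw [h]; simp only [mul_assoc]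

theorem fa_mem : fa ∈ foursH := Subgroup.subset_closure (by simp)
theorem fb_mem : fb ∈ foursH := Subgroup.subset_closure (by simp)
theorem fc_mem : fc ∈ foursH := Subgroup.subset_closure (by simp)

theorem foursH_le_comap_conj {g : Fours} (ha : g * fa * g⁻¹ ∈ foursH)
    (hb : g * fb * g⁻¹ ∈ foursH) (hc : g * fc * g⁻¹ ∈ foursH) {h : Fours} (hh : h ∈ foursH) :
    g * h * g⁻¹ ∈ foursH := by
  have : foursH ≤ foursH.comap (MulAut.conj g).toMonoidHom := by
    refine (Subgroup.closure_le _).mpr ?_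
    rintro _ (rfl | rfl | rfl)
    exacts [ha, hb, hc]
  exact this hh

theorem fx_conj_mem {h : Fours} (hh : h ∈ foursH) : fx * h * fx⁻¹ ∈ foursH := by
  refine foursH_le_comap_conj ?_ ?_ ?_ hh
  · simpa [commute_fx_fa.eq] using fa_mem
  · simpa [semiconjBy_fx_fb.eq] using fb_mem
  · simpa [semiconjBy_fx_fc.eq] using fc_mem

theorem fy_conj_mem {h : Fours} (hh : h ∈ foursH) : fy * h * fy⁻¹ ∈ foursH := by
  refine foursH_le_comap_conj ?_ ?_ ?_ hh
  · simpa [semiconjBy_fy_fa.eq] using fa_mem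
  · simpa [commute_fy_fb.eq] using fb_mem
  · simpa [semiconjBy_fy_fc.eq] using fc_mem

/-- Every coset of `H` contains one of `1`, `x`, `y`, `xy`. -/
theorem exists_coset_rep (g : Fours) :
    ∃ t : Fours, (t = 1 ∨ t = fx ∨ t = fy ∨ t = fx * fy) ∧ g * t⁻¹ ∈ foursH := by
  have hx : ∀ g : Fours, (∃ t : Fours, (t = 1 ∨ t = fx ∨ t = fy ∨ t = fx * fy) ∧
      g * t⁻¹ ∈ foursH) → ∃ t : Fours, (t = 1 ∨ t = fx ∨ t = fy ∨ t = fx * fy) ∧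
      fx * g * t⁻¹ ∈ foursH := by
    rintro g ⟨t, ht, hg⟩
    have key (s u : Fours) (hu : u ∈ foursH) (h : fx * t = u * s) : fx * g * s⁻¹ ∈ foursH := by
      convert mul_mem (fx_conj_mem hg) hu using 1
      rw [eq_mul_inv_of_mul_eq h.symm]; group
    rcases ht with rfl | rfl | rfl | rfl
    · exact ⟨fx, by simp, key _ 1 (one_mem _) (by simp)⟩
    · exact ⟨1, by simp, key _ fa fa_mem (by simp [fa, pow_two])⟩
    · exact ⟨fx * fy, by simp, key _ 1 (one_mem _) (by simp)⟩
    · exact ⟨fy, by simp, key _ fa fa_mem (by simp [fa, pow_two, mul_assoc])⟩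
  have hy : ∀ g : Fours, (∃ t : Fours, (t = 1 ∨ t = fx ∨ t = fy ∨ t = fx * fy) ∧
      g * t⁻¹ ∈ foursH) → ∃ t : Fours, (t = 1 ∨ t = fx ∨ t = fy ∨ t = fx * fy) ∧
      fy * g * t⁻¹ ∈ foursH := by
    rintro g ⟨t, ht, hg⟩
    have key (s u : Fours) (hu : u ∈ foursH) (h : fy * t = u * s) : fy * g * s⁻¹ ∈ foursH := by
      convert mul_mem (fy_conj_mem hg) hu using 1
      rw [eq_mul_inv_of_mul_eq h.symm]; group
    have hw : fc⁻¹ * fa⁻¹ * fb ∈ foursH :=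
      mul_mem (mul_mem (inv_mem fc_mem) (inv_mem fa_mem)) fb_mem
    rcases ht with rfl | rfl | rfl | rfl
    · exact ⟨fy, by simp, key _ 1 (one_mem _) (by simp)⟩
    · exact ⟨fx * fy, by simp, key _ _ hw fy_mul_fx⟩
    · exact ⟨1, by simp, key _ fb fb_mem (by simp [fb, pow_two])⟩
    · refine ⟨fx, by simp, key _ (fc⁻¹ * fa⁻¹ * fb * fb⁻¹) (mul_mem hw (inv_mem fb_mem)) ?_⟩
      calc fy * (fx * fy) = fc⁻¹ * fa⁻¹ * fb * (fx * fb) := by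
            rw [← mul_assoc, fy_mul_fx]; simp only [fb, pow_two]; group
        _ = fc⁻¹ * fa⁻¹ * fb * fb⁻¹ * fx := by
            rw [semiconjBy_fx_fb.eq]; group
  have hmul : ∀ u ∈ foursH, ∀ g : Fours, (∃ t : Fours, (t = 1 ∨ t = fx ∨ t = fy ∨ t = fx * fy) ∧
      g * t⁻¹ ∈ foursH) → ∃ t : Fours, (t = 1 ∨ t = fx ∨ t = fy ∨ t = fx * fy) ∧
      u * g * t⁻¹ ∈ foursH := by
    rintro u hu g ⟨t, ht, hg⟩
    exact ⟨t, ht, by simpa [mul_assoc] using mul_mem hu hg⟩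
  have hg : g ∈ Subgroup.closure {fx, fy} := closure_fx_fy ▸ Subgroup.mem_top g
  induction hg using Subgroup.closure_induction_left with
  | one => exact ⟨1, by simp, by simp⟩
  | mul_left z hz g _ ih =>
    rcases hz with rfl | rfl
    exacts [hx g ih, hy g ih]
  | inv_mul_cancel z hz g _ ih =>
    rcases hz with rfl | rfl
    · convert hmul _ (inv_mem fa_mem) _ (hx g ih) using 5
      rw [fa]; group
    · convert hmul _ (inv_mem fb_mem) _ (hy g ih) using 5
      rw [fb]; group

/-- The homomorphism onto the Klein four group given by the parities of `x` and `y`. -/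
def foursParity : Fours →* Multiplicative (ZMod 2 × ZMod 2) :=
  PresentedGroup.toGroup (rels := foursRels)
    (f := ![Multiplicative.ofAdd (1, 0), Multiplicative.ofAdd (0, 1)]) (by
      rintro _ (rfl | rfl) <;> simp <;> decide)

theorem foursParity_fx : foursParity fx = Multiplicative.ofAdd (1, 0) :=
  PresentedGroup.toGroup.of _

theorem foursParity_fy : foursParity fy = Multiplicative.ofAdd (0, 1) :=
  PresentedGroup.toGroup.of _

theorem foursH_le_ker : foursH ≤ foursParity.ker := by
  refine (Subgroup.closure_le _).mpr ?_
  rintro _ (rfl | rfl | rfl) <;>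
    simp only [fa, fb, fc, SetLike.mem_coe, MonoidHom.mem_ker, map_pow, map_mul, foursParity_fx,
      foursParity_fy] <;> decide

theorem foursParity_injOn {s t : Fours} (hs : s = 1 ∨ s = fx ∨ s = fy ∨ s = fx * fy)
    (ht : t = 1 ∨ t = fx ∨ t = fy ∨ t = fx * fy) (h : foursParity s = foursParity t) : s = t := by
  rcases hs with rfl | rfl | rfl | rfl <;> rcases ht with rfl | rfl | rfl | rfl <;>
    first
    | rfl
    | (simp only [map_one, map_mul, foursParity_fx, foursParity_fy] at h
       exact absurd h (by decide))

theorem foursParity_eq_of_mem {g t : Fours} (h : g * t⁻¹ ∈ foursH) :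
    foursParity g = foursParity t := by
  simpa [MonoidHom.mem_ker, mul_inv_eq_one] using foursH_le_ker h

theorem ker_foursParity : foursParity.ker = foursH := by
  refine le_antisymm (fun g hg ↦ ?_) foursH_le_ker
  obtain ⟨t, ht, h⟩ := exists_coset_rep g
  have : t = 1 := foursParity_injOn ht (Or.inl rfl)
    ((foursParity_eq_of_mem h).symm.trans (hg.trans (map_one _).symm))
  simpa [this] using h

theorem foursParity_surjective : Function.Surjective foursParity := by
  have h : ∀ z : Multiplicative (ZMod 2 × ZMod 2), z = 1 ∨ z = Multiplicative.ofAdd (1, 0) ∨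
      z = Multiplicative.ofAdd (0, 1) ∨
      z = Multiplicative.ofAdd (1, 0) * Multiplicative.ofAdd (0, 1) := by decide
  intro z
  rcases h z with rfl | rfl | rfl | rfl
  exacts [⟨1, map_one _⟩, ⟨fx, foursParity_fx⟩, ⟨fy, foursParity_fy⟩,
    ⟨fx * fy, by rw [map_mul, foursParity_fx, foursParity_fy]⟩]

/-- The generator `x` as a screw motion of `ℤ³`. -/
def screwX : Equiv.Perm (ℤ × ℤ × ℤ) where
  toFun v := (v.1 + 1, -v.2.1, 1 - v.2.2)
  invFun v := (v.1 - 1, -v.2.1, 1 - v.2.2)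
  left_inv v := by simp
  right_inv v := by simp

/-- The generator `y` as a screw motion of `ℤ³`. -/
def screwY : Equiv.Perm (ℤ × ℤ × ℤ) where
  toFun v := (-v.1, v.2.1 + 1, -v.2.2)
  invFun v := (-v.1, v.2.1 - 1, -v.2.2)
  left_inv v := by simp
  right_inv v := by simp

/-- The action of `Γ` on `ℤ³` by screw motions. -/
def foursAction : Fours →* Equiv.Perm (ℤ × ℤ × ℤ) :=
  PresentedGroup.toGroup (rels := foursRels) (f := ![screwX, screwY]) (by
    rintro _ (rfl | rfl) <;> ext v <;>
      simp [pow_two, screwX, screwY, Equiv.Perm.inv_def])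

theorem foursAction_fx : foursAction fx = screwX := PresentedGroup.toGroup.of _

theorem foursAction_fy : foursAction fy = screwY := PresentedGroup.toGroup.of _

/-- The homomorphism `(i, j, k) ↦ aⁱ bʲ cᵏ`. -/
def foursLattice : Multiplicative (ℤ × ℤ × ℤ) →* Fours where
  toFun v := fa ^ v.toAdd.1 * fb ^ v.toAdd.2.1 * fc ^ v.toAdd.2.2
  map_one' := by simp
  map_mul' u v := by
    simp only [toAdd_mul, Prod.fst_add, Prod.snd_add, zpow_add]
    have hab := (commute_fa_fb.zpow_zpow v.toAdd.1 u.toAdd.2.1).eq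
    have hac := (commute_fa_fc.zpow_zpow v.toAdd.1 u.toAdd.2.2).eq
    have hbc := (commute_fb_fc.zpow_zpow v.toAdd.2.1 u.toAdd.2.2).eq
    simp only [mul_assoc]
    rw [← mul_assoc (fc ^ u.toAdd.2.2) (fa ^ _), ← hac, mul_assoc,
      ← mul_assoc (fc ^ u.toAdd.2.2) (fb ^ _), ← hbc, mul_assoc,
      ← mul_assoc (fb ^ u.toAdd.2.1) (fa ^ _), ← hab, mul_assoc]

theorem foursAction_fa : foursAction fa = Equiv.addRight (2, 0, 0) := by
  rw [fa, map_pow, foursAction_fx]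
  ext v <;> simp [pow_two, screwX, add_assoc]

theorem foursAction_fb : foursAction fb = Equiv.addRight (0, 2, 0) := by
  rw [fb, map_pow, foursAction_fy]
  ext v <;> simp [pow_two, screwY, add_assoc]

theorem foursAction_fc : foursAction fc = Equiv.addRight (0, 0, 2) := by
  rw [fc, map_pow, map_mul, foursAction_fx, foursAction_fy]
  ext v <;> simp [pow_two, screwX, screwY]; ring

theorem foursAction_foursLattice (v : Multiplicative (ℤ × ℤ × ℤ)) :
    foursAction (foursLattice v) 0 = (2 : ℤ) • v.toAdd := by
  simp [foursLattice, foursAction_fa, foursAction_fb, foursAction_fc, mul_comm, Prod.ext_iff]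

theorem foursLattice_injective : Function.Injective foursLattice := by
  intro u v h
  have := foursAction_foursLattice u
  rw [h, foursAction_foursLattice, smul_right_inj two_ne_zero] at this
  exact Multiplicative.toAdd.injective this.symm

theorem range_foursLattice : foursLattice.range = foursH := by
  apply le_antisymm
  · rintro _ ⟨v, rfl⟩
    exact mul_mem (mul_mem (zpow_mem fa_mem _) (zpow_mem fb_mem _)) (zpow_mem fc_mem _)
  · refine (Subgroup.closure_le _).mpr ?_
    rintro _ (rfl | rfl | rfl)
    exacts [⟨.ofAdd (1, 0, 0), by simp [foursLattice]⟩, ⟨.ofAdd (0, 1, 0), by simp [foursLattice]⟩,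
      ⟨.ofAdd (0, 0, 1), by simp [foursLattice]⟩]

/-- `H = ⟨x², y², (xy)²⟩` is normal in `Γ`, is free abelian of rank `3`, the quotient
`Γ/H` is the Klein four group `ℤ/2 × ℤ/2` (expressed via a surjective homomorphism with
kernel `H`), and `{1, x, y, xy}` is a complete set of coset representatives for `H`. -/
theorem H_normal_free_abelian_klein_quotient :
    foursH.Normal ∧
    Nonempty (↥foursH ≃* Multiplicative (ℤ × ℤ × ℤ)) ∧
    (∃ φ : Fours →* Multiplicative (ZMod 2 × ZMod 2), Function.Surjective φ ∧
      φ.ker = foursH) ∧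
    (∀ g : Fours, ∃! t : Fours, (t = 1 ∨ t = fx ∨ t = fy ∨ t = fx * fy) ∧
      g * t⁻¹ ∈ foursH) := by
  refine ⟨ker_foursParity ▸ inferInstance, ?_,
    ⟨foursParity, foursParity_surjective, ker_foursParity⟩, fun g ↦ ?_⟩
  · rw [← range_foursLattice]
    exact ⟨(MonoidHom.ofInjective foursLattice_injective).symm⟩
  · obtain ⟨t, ht, h⟩ := exists_coset_rep g
    exact ⟨t, ⟨ht, h⟩, fun s hs ↦ foursParity_injOn hs.1 ht
      ((foursParity_eq_of_mem hs.2).symm.trans (foursParity_eq_of_mem h))⟩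
end
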